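/- Fix an integer N ≥ 2 and let μ be a non-atomic Borel probability measure on [0,1]. Then for every n ∈ ℕ and every x ∈ [0,1], the Gauss–Kuzmin-type equation holds: F_{N,n+1}(x) = Σ_{i≥N} [ F_{N,n}(1 − N/(x+i)) − F_{N,n}(1 − N/i) ]. -/

import Mathlib

open MeasureTheory Set Filter

/-- The Rényi-type continued fraction transformation
`R_N(x) = N/(1-x) - ⌊N/(1-x)⌋` for `x ≠ 1`, and `R_N(1) = 0`. -/
noncomputable def renyiMap (N : ℕ) (x : ℝ) : ℝ :=
  if x = 1 then 0 else Int.fract ((N : ℝ) / (1 - x))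

/-- `F_{N,n}(x) = μ {y ∈ [0,1] : R_N^n(y) ≤ x}`. -/
noncomputable def Fdist (N : ℕ) (μ : Measure ℝ) (n : ℕ) (x : ℝ) : ℝ :=
  (μ {y ∈ Icc (0 : ℝ) 1 | (renyiMap N)^[n] y ≤ x}).toReal

lemma renyiMap_mem_Icc (N : ℕ) (x : ℝ) : renyiMap N x ∈ Icc (0 : ℝ) 1 := by
  unfold renyiMap
  split_ifs
  · simp
  · exact ⟨Int.fract_nonneg _, (Int.fract_lt_one _).le⟩

lemma measurable_renyiMap (N : ℕ) : Measurable (renyiMap N) := by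
  unfold renyiMap
  exact Measurable.ite (measurableSet_singleton 1) measurable_const
    (measurable_fract.comp (by fun_prop))

lemma iterate_renyiMap_mem_Icc (N n : ℕ) {y : ℝ} (hy : y ∈ Icc (0 : ℝ) 1) :
    (renyiMap N)^[n] y ∈ Icc (0 : ℝ) 1 :=
  MapsTo.iterate (fun _ _ => renyiMap_mem_Icc N _) n hy

lemma countable_renyiMap_fiber {N : ℕ} (hN : N ≠ 0) (c : ℝ) :
    (renyiMap N ⁻¹' {c}).Countable := by
  refine ((countable_singleton (1 : ℝ)).union
    (countable_range fun k : ℤ => 1 - (N : ℝ) / (k + c))).mono fun y hy => ?_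
  by_cases h1 : y = 1
  · exact Or.inl h1
  · refine Or.inr ⟨⌊(N : ℝ) / (1 - y)⌋, ?_⟩
    have hc : Int.fract ((N : ℝ) / (1 - y)) = c := by
      simpa [renyiMap, h1] using hy
    have hN' : (N : ℝ) ≠ 0 := Nat.cast_ne_zero.mpr hN
    simp only [← hc, Int.floor_add_fract]
    rw [div_div_cancel₀ hN']
    ring

lemma countable_iterate_renyiMap_fiber {N : ℕ} (hN : N ≠ 0) (n : ℕ) (c : ℝ) :
    ((renyiMap N)^[n] ⁻¹' {c}).Countable := by
  induction n generalizing c with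
  | zero => simp
  | succ n ih =>
    rw [Function.iterate_succ', preimage_comp, ← biUnion_preimage_singleton]
    exact (countable_renyiMap_fiber hN c).biUnion fun d _ => ih d

lemma le_one_sub_div_iff {a z t : ℝ} (hz : z < 1) (ht : 0 < t) :
    z ≤ 1 - a / t ↔ a / (1 - z) ≤ t := by
  rw [le_sub_comm, div_le_iff₀ ht, div_le_iff₀ (sub_pos.mpr hz), mul_comm]

/-- The points of the `j`-th branch at which `renyiMap N ≤ x`, without the left endpoint. -/
lemma mem_Ioc_branch_iff {N : ℕ} (hN : N ≠ 0) {x : ℝ} (hx : 0 ≤ x) (j : ℕ) (z : ℝ) :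
    z ∈ Ioc (1 - (N : ℝ) / ((j + N : ℕ) : ℝ)) (1 - (N : ℝ) / (x + ((j + N : ℕ) : ℝ))) ↔
      z < 1 ∧ (N : ℝ) / (1 - z) ∈ Ioc ((j + N : ℕ) : ℝ) (x + ((j + N : ℕ) : ℝ)) := by
  have hN' : (0 : ℝ) < N := Nat.cast_pos.mpr (Nat.pos_of_ne_zero hN)
  have hi : (0 : ℝ) < ((j + N : ℕ) : ℝ) := Nat.cast_pos.mpr (by lia)
  have hxi : 0 < x + ((j + N : ℕ) : ℝ) := by linarith
  constructor
  · rintro ⟨h1, h2⟩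
    have hz : z < 1 := h2.trans_lt (sub_lt_self _ (div_pos hN' hxi))
    exact ⟨hz, not_le.mp fun h => h1.not_ge ((le_one_sub_div_iff hz hi).mpr h),
      (le_one_sub_div_iff hz hxi).mp h2⟩
  · rintro ⟨hz, h1, h2⟩
    exact ⟨not_le.mp fun h => h1.not_ge ((le_one_sub_div_iff hz hi).mp h),
      (le_one_sub_div_iff hz hxi).mpr h2⟩

lemma renyiMap_le_iff {N : ℕ} (hN : N ≠ 0) {x z : ℝ} (hx : x ∈ Icc (0 : ℝ) 1)
    (hz : z ∈ Icc (0 : ℝ) 1) (h0 : renyiMap N z ≠ 0) :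
    renyiMap N z ≤ x ↔ ∃ j : ℕ,
      z ∈ Ioc (1 - (N : ℝ) / ((j + N : ℕ) : ℝ)) (1 - (N : ℝ) / (x + ((j + N : ℕ) : ℝ))) := by
  have hz1 : z ≠ 1 := fun h => h0 (by simp [renyiMap, h])
  have hlt : z < 1 := lt_of_le_of_ne hz.2 hz1
  simp only [mem_Ioc_branch_iff hN hx.1, hlt, true_and]
  simp only [renyiMap, hz1, if_false] at h0 ⊢
  have hw : (N : ℝ) ≤ (N : ℝ) / (1 - z) :=
    le_div_self N.cast_nonneg (sub_pos.mpr hlt) (by linarith [hz.1])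
  generalize (N : ℝ) / (1 - z) = w at *
  have hfl := Int.floor_add_fract w
  have hpos : 0 < Int.fract w := lt_of_le_of_ne (Int.fract_nonneg w) (Ne.symm h0)
  constructor
  · intro h
    have hNf : (N : ℤ) ≤ ⌊w⌋ := Int.le_floor.mpr (by exact_mod_cast hw)
    have hj : (((⌊w⌋ - N).toNat + N : ℕ) : ℤ) = ⌊w⌋ := by lia
    have hj' : (((⌊w⌋ - N).toNat + N : ℕ) : ℝ) = ⌊w⌋ := by exact_mod_cast hj
    refine ⟨(⌊w⌋ - N).toNat, ?_⟩
    rw [hj']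
    constructor <;> linarith
  · rintro ⟨j, h1, h2⟩
    have hne : w ≠ ((j + N : ℕ) : ℝ) + 1 := by
      rintro rfl
      refine h0 ?_
      exact_mod_cast Int.fract_natCast (R := ℝ) (j + N + 1)
    have hf : ⌊w⌋ = ((j + N : ℕ) : ℤ) := by
      rw [Int.floor_eq_iff]
      exact ⟨by exact_mod_cast h1.le,
        by exact_mod_cast lt_of_le_of_ne (by linarith [hx.2]) hne⟩
    have hf' : (⌊w⌋ : ℝ) = ((j + N : ℕ) : ℝ) := by exact_mod_cast hf
    linarith

lemma pairwise_disjoint_branch {N : ℕ} (hN : N ≠ 0) {x : ℝ} (hx : x ∈ Icc (0 : ℝ) 1) :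
    Pairwise (Function.onFun Disjoint fun j : ℕ =>
      Ioc (1 - (N : ℝ) / ((j + N : ℕ) : ℝ)) (1 - (N : ℝ) / (x + ((j + N : ℕ) : ℝ)))) := by
  intro j k hjk
  refine Set.disjoint_left.mpr fun z hj hk => hjk ?_
  obtain ⟨-, hj1, hj2⟩ := (mem_Ioc_branch_iff hN hx.1 j z).mp hj
  obtain ⟨-, hk1, hk2⟩ := (mem_Ioc_branch_iff hN hx.1 k z).mp hk
  have h1 : ((j + N : ℕ) : ℝ) < ((k + N + 1 : ℕ) : ℝ) := by
    push_cast at *; linarith [hx.2]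
  have h2 : ((k + N : ℕ) : ℝ) < ((j + N + 1 : ℕ) : ℝ) := by
    push_cast at *; linarith [hx.2]
  rw [Nat.cast_lt] at h1 h2
  lia

lemma measurableSet_iterate_renyiMap (N n : ℕ) {s : Set ℝ} (hs : MeasurableSet s) :
    MeasurableSet {y ∈ Icc (0 : ℝ) 1 | (renyiMap N)^[n] y ∈ s} :=
  measurableSet_Icc.inter ((measurable_renyiMap N).iterate n hs)

lemma Fdist_sub_Fdist (N : ℕ) (μ : Measure ℝ) [IsFiniteMeasure μ] (n : ℕ) {a b : ℝ}
    (hab : a ≤ b) :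
    Fdist N μ n b - Fdist N μ n a =
      μ.real {y ∈ Icc (0 : ℝ) 1 | (renyiMap N)^[n] y ∈ Ioc a b} := by
  have hset : {y ∈ Icc (0 : ℝ) 1 | (renyiMap N)^[n] y ∈ Ioc a b} =
      {y ∈ Icc (0 : ℝ) 1 | (renyiMap N)^[n] y ≤ b} \
        {y ∈ Icc (0 : ℝ) 1 | (renyiMap N)^[n] y ≤ a} := by
    ext y
    simp only [mem_ofPred_eq, Set.mem_sdiff, mem_Ioc, not_and, not_le]
    tauto
  have hsub : {y ∈ Icc (0 : ℝ) 1 | (renyiMap N)^[n] y ≤ a} ⊆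
      {y ∈ Icc (0 : ℝ) 1 | (renyiMap N)^[n] y ≤ b} := fun y hy => ⟨hy.1, hy.2.trans hab⟩
  rw [hset, measureReal_sdiff hsub (measurableSet_iterate_renyiMap N n measurableSet_Iic)]
  rfl

/-- The Gauss-Kuzmin-type equation, with the sum over `i ≥ N` written via `i = j + N`. -/
theorem gauss_kuzmin_equation (N : ℕ) (hN : 2 ≤ N) (μ : Measure ℝ)
    [IsProbabilityMeasure μ] [NullSingletonClass μ] (hsupp : μ (Icc (0 : ℝ) 1)ᶜ = 0) :
    ∀ n : ℕ, ∀ x ∈ Icc (0 : ℝ) 1,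
      Fdist N μ (n + 1) x =
        ∑' j : ℕ,
          (Fdist N μ n (1 - (N : ℝ) / (x + ((j + N : ℕ) : ℝ))) -
            Fdist N μ n (1 - (N : ℝ) / ((j + N : ℕ) : ℝ))) := by
  intro n x hx
  have hN0 : N ≠ 0 := by lia
  have hle (j : ℕ) :
      1 - (N : ℝ) / ((j + N : ℕ) : ℝ) ≤ 1 - (N : ℝ) / (x + ((j + N : ℕ) : ℝ)) := by
    have hi : (0 : ℝ) < ((j + N : ℕ) : ℝ) := Nat.cast_pos.mpr (by lia)
    have := hx.1
    gcongr
    linarith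
  simp only [Fdist_sub_Fdist N μ n (hle _), measureReal_def]
  rw [← ENNReal.tsum_toReal_eq (fun _ => measure_ne_top _ _), ← measure_iUnion
    (fun j k hjk => Set.disjoint_left.mpr fun y hj hk =>
      Set.disjoint_left.mp (pairwise_disjoint_branch hN0 hx hjk) hj.2 hk.2)
    (fun j => measurableSet_iterate_renyiMap N n measurableSet_Ioc), Fdist]
  congr 1
  refine measure_congr (eventuallyEq_set.mpr ?_)
  have hnull : ∀ᵐ y ∂μ, (renyiMap N)^[n + 1] y ≠ 0 :=
    (countable_iterate_renyiMap_fiber hN0 (n + 1) 0).ae_notMem μ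
  filter_upwards [hnull] with y hy
  rw [Function.iterate_succ_apply'] at hy
  simp only [mem_iUnion, mem_ofPred_eq, exists_and_left, Function.iterate_succ_apply']
  exact and_congr_right fun hyI =>
    renyiMap_le_iff hN0 hx (iterate_renyiMap_mem_Icc N n hyI) hy
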